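/- Let 0 < a < b be real numbers, and define g(x) = π/2 + arccos(2ax/(x² + a²)) + arcsin(2bx/(x² + b²)) for 0 < x < a. Then g is differentiable on (0, a) with g′(x) = 2(x² − ab)(b − a)/((a² + x²)(b² + x²)); in particular g′(x) < 0 for all 0 < x < a, so g is strictly decreasing on (0, a). -/

import Mathlib

open Real

/-- On `(-c, c)` the function `arcsin (2cx/(x²+c²))` has the derivative of `2 arctan (x/c)`. -/
theorem hasDerivAt_arcsin_two_mul_div {c x : ℝ} (hx : |x| < c) :
    HasDerivAt (fun y : ℝ => arcsin (2 * c * y / (y ^ 2 + c ^ 2))) (2 * c / (c ^ 2 + x ^ 2)) x := by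
  obtain ⟨h₁, h₂⟩ := abs_lt.mp hx
  have hc : 0 < c := (abs_nonneg x).trans_lt hx
  have hd : 0 < x ^ 2 + c ^ 2 := by positivity
  have hsub : 0 < c ^ 2 - x ^ 2 := by nlinarith
  have hne_neg : 2 * c * x / (x ^ 2 + c ^ 2) ≠ -1 := by
    rw [Ne, div_eq_iff hd.ne']
    intro h
    nlinarith [mul_pos (neg_lt_iff_pos_add.mp h₁) (neg_lt_iff_pos_add.mp h₁)]
  have hne : 2 * c * x / (x ^ 2 + c ^ 2) ≠ 1 := by
    rw [Ne, div_eq_iff hd.ne']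
    intro h
    nlinarith [mul_pos (sub_pos.mpr h₂) (sub_pos.mpr h₂)]
  have hsqrt : √(1 - (2 * c * x / (x ^ 2 + c ^ 2)) ^ 2) = (c ^ 2 - x ^ 2) / (x ^ 2 + c ^ 2) := by
    rw [show 1 - (2 * c * x / (x ^ 2 + c ^ 2)) ^ 2 = ((c ^ 2 - x ^ 2) / (x ^ 2 + c ^ 2)) ^ 2 by
      field_simp
      ring]
    exact Real.sqrt_sq (by positivity)
  have hinner : HasDerivAt (fun y : ℝ => 2 * c * y / (y ^ 2 + c ^ 2))
      ((2 * c * 1 * (x ^ 2 + c ^ 2) - 2 * c * x * (2 * x)) / (x ^ 2 + c ^ 2) ^ 2) x := by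
    refine ((hasDerivAt_id x).const_mul (2 * c)).fun_div ?_ hd.ne'
    simpa using (hasDerivAt_pow 2 x).add_const (c ^ 2)
  refine ((hasDerivAt_arcsin hne_neg hne).comp x hinner).congr_deriv ?_
  rw [hsqrt, add_comm (c ^ 2)]
  have := hsub.ne'
  field_simp
  ring

/-- For `0 < a < b`, the angle-sum function
`g(x) = π/2 + arccos (2ax/(x²+a²)) + arcsin (2bx/(x²+b²))` on `(0, a)` has derivative
`2(x² − ab)(b − a)/((a²+x²)(b²+x²))`, which is negative, so `g` is strictly decreasing. -/
theorem stmt_6 (a b : ℝ) (ha : 0 < a) (hab : a < b)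
    (g : ℝ → ℝ)
    (hg : ∀ x : ℝ, g x =
      π / 2 + arccos (2 * a * x / (x ^ 2 + a ^ 2)) + arcsin (2 * b * x / (x ^ 2 + b ^ 2))) :
    (∀ x ∈ Set.Ioo (0 : ℝ) a,
      HasDerivAt g (2 * (x ^ 2 - a * b) * (b - a) / ((a ^ 2 + x ^ 2) * (b ^ 2 + x ^ 2))) x) ∧
    (∀ x ∈ Set.Ioo (0 : ℝ) a,
      2 * (x ^ 2 - a * b) * (b - a) / ((a ^ 2 + x ^ 2) * (b ^ 2 + x ^ 2)) < 0) ∧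
    StrictAntiOn g (Set.Ioo (0 : ℝ) a) := by
  have hderiv : ∀ x ∈ Set.Ioo (0 : ℝ) a,
      HasDerivAt g (2 * (x ^ 2 - a * b) * (b - a) / ((a ^ 2 + x ^ 2) * (b ^ 2 + x ^ 2))) x := by
    intro x hx
    have hxa : |x| < a := by rw [abs_of_pos hx.1]; exact hx.2
    have hsum := ((hasDerivAt_arcsin_two_mul_div hxa).const_sub (π / 2)).const_add (π / 2)
      |>.fun_add (hasDerivAt_arcsin_two_mul_div (hxa.trans hab))
    rw [funext hg]
    refine hsum.congr_deriv ?_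
    have hA : 0 < a ^ 2 + x ^ 2 := by positivity
    have hB : 0 < b ^ 2 + x ^ 2 := by have := ha.trans hab; positivity
    field_simp
    ring
  have hneg : ∀ x ∈ Set.Ioo (0 : ℝ) a,
      2 * (x ^ 2 - a * b) * (b - a) / ((a ^ 2 + x ^ 2) * (b ^ 2 + x ^ 2)) < 0 := by
    rintro x ⟨hx₀, hx₁⟩
    have hlt : x ^ 2 - a * b < 0 := by nlinarith
    refine div_neg_of_neg_of_pos ?_ (by positivity)
    exact mul_neg_of_neg_of_pos (by linarith) (sub_pos.mpr hab)
  refine ⟨hderiv, hneg, strictAntiOn_of_deriv_neg (convex_Ioo 0 a)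
    (fun x hx => (hderiv x hx).continuousAt.continuousWithinAt) fun x hx => ?_⟩
  rw [interior_Ioo] at hx
  rw [(hderiv x hx).deriv]
  exact hneg x hx
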